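/- arXiv:1705.00418 — 3 statements merged into one kernel-verified Lean document; each statement's English description precedes it below -/
import Mathlib

section
/- Let I ⊆ ℝ be an open interval, U ⊆ ℝ³ open, and let u, h : I×U → ℝ³ be C² and satisfy on I×U the induction equation ∂_t h + (u·∇)h − (h·∇)u = 0 together with div u = 0 and div h = 0. Set ω = ∇×u and j = ∇×h. Then on I×U: ∂_t j + (u·∇)j − (h·∇)ω = (j·∇)u − (ω·∇)h − 2 Σ_{l=1}^{3} ∇u_l × ∇h_l, where ∇u_l and ∇h_l are the spatial gradients of the l-th components. -/
noncomputable section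

abbrev P2 : Type := ℝ × ℝ
abbrev P3 : Type := ℝ × ℝ × ℝ

/-- Standard basis of ℝ³. -/
def e3 : Fin 3 → P3 := ![(1, 0, 0), (0, 1, 0), (0, 0, 1)]

/-- Components of a vector in ℝ³. -/
def c3 : Fin 3 → P3 → ℝ := ![fun a => a.1, fun a => a.2.1, fun a => a.2.2]

/-- Euclidean dot product on ℝ³. -/
def dot3 (a b : P3) : ℝ := a.1 * b.1 + a.2.1 * b.2.1 + a.2.2 * b.2.2

/-- Cross product on ℝ³. -/
def cross3 (a b : P3) : P3 :=
  (a.2.1 * b.2.2 - a.2.2 * b.2.1, a.2.2 * b.1 - a.1 * b.2.2, a.1 * b.2.1 - a.2.1 * b.1)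

/-- Time derivative ∂_t of a time-dependent vector field on ℝ×ℝ³. -/
def pdtv (v : ℝ × P3 → P3) (z : ℝ × P3) : P3 := fderiv ℝ v z (1, 0)

/-- Time derivative ∂_t of a time-dependent scalar function on ℝ×ℝ³. -/
def pdts (g : ℝ × P3 → ℝ) (z : ℝ × P3) : ℝ := fderiv ℝ g z (1, 0)

/-- Spatial partial derivative ∂ᵢ of a time-dependent vector field on ℝ×ℝ³. -/
def spdv (i : Fin 3) (v : ℝ × P3 → P3) (z : ℝ × P3) : P3 := fderiv ℝ v z (0, e3 i)

/-- Spatial partial derivative ∂ᵢ of a time-dependent scalar function on ℝ×ℝ³. -/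
def spd (i : Fin 3) (g : ℝ × P3 → ℝ) (z : ℝ × P3) : ℝ := fderiv ℝ g z (0, e3 i)

/-- The advective derivative (a·∇)v = Σ_k a_k ∂_k v (spatial derivatives only). -/
def advt (a v : ℝ × P3 → P3) (z : ℝ × P3) : P3 := ∑ i : Fin 3, c3 i (a z) • spdv i v z

/-- The spatial gradient of a time-dependent scalar function. -/
def gradt (p : ℝ × P3 → ℝ) (z : ℝ × P3) : P3 := (spd 0 p z, spd 1 p z, spd 2 p z)

/-- The spatial divergence of a time-dependent vector field. -/
def divt (v : ℝ × P3 → P3) (z : ℝ × P3) : ℝ := ∑ i : Fin 3, spd i (fun w => c3 i (v w)) z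

/-- The spatial curl ∇×v of a time-dependent vector field. -/
def curlt (v : ℝ × P3 → P3) (z : ℝ × P3) : P3 :=
  (spd 1 (fun w => c3 2 (v w)) z - spd 2 (fun w => c3 1 (v w)) z,
   spd 2 (fun w => c3 0 (v w)) z - spd 0 (fun w => c3 2 (v w)) z,
   spd 0 (fun w => c3 1 (v w)) z - spd 1 (fun w => c3 0 (v w)) z)

/-- Standard basis of ℝ². -/
def e2 : Fin 2 → P2 := ![(1, 0), (0, 1)]

/-- Spatial partial derivative ∂ᵢ of a time-dependent function on ℝ×ℝ². -/
def spd2 (i : Fin 2) (g : ℝ × P2 → ℝ) (z : ℝ × P2) : ℝ := fderiv ℝ g z (0, e2 i)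

/-- Time derivative ∂_t of a time-dependent function on ℝ×ℝ². -/
def pdt2 (g : ℝ × P2 → ℝ) (z : ℝ × P2) : ℝ := fderiv ℝ g z (1, 0)

/-- The space-time point (t, x', f(t,x')) on the moving graph. -/
def grt (f : ℝ × P2 → ℝ) (t : ℝ) (x : P2) : ℝ × P3 := (t, (x.1, x.2, f (t, x)))

/-- The (non-unit) normal N_f = (−∂₁f, −∂₂f, 1) of the moving graph. -/
def Nft (f : ℝ × P2 → ℝ) (t : ℝ) (x : P2) : P3 :=
  (-(spd2 0 f (t, x)), -(spd2 1 f (t, x)), 1)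

/-- The components `c3 k` as continuous linear functionals. -/
def c3L : Fin 3 → P3 →L[ℝ] ℝ :=
  ![ContinuousLinearMap.fst ℝ ℝ (ℝ × ℝ),
    (ContinuousLinearMap.fst ℝ ℝ ℝ).comp (ContinuousLinearMap.snd ℝ ℝ (ℝ × ℝ)),
    (ContinuousLinearMap.snd ℝ ℝ ℝ).comp (ContinuousLinearMap.snd ℝ ℝ (ℝ × ℝ))]

lemma c3_eq_c3L (k : Fin 3) (a : P3) : c3 k a = c3L k a := by
  fin_cases k <;> rfl

lemma ext_c3 {a b : P3} (hab : ∀ k, c3 k a = c3 k b) : a = b :=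
  Prod.ext (hab 0) (Prod.ext (hab 1) (hab 2))

lemma c3_fderiv {v : ℝ × P3 → P3} {z : ℝ × P3} (hv : DifferentiableAt ℝ v z) (k : Fin 3)
    (w : ℝ × P3) : c3 k (fderiv ℝ v z w) = fderiv ℝ (fun x => c3 k (v x)) z w := by
  simp only [c3_eq_c3L]
  have := ((c3L k).hasFDerivAt.comp z hv.hasFDerivAt).fderiv
  simp only [Function.comp_def] at this
  rw [this]
  rfl

lemma c3_advt (a : ℝ × P3 → P3) {v : ℝ × P3 → P3} {z : ℝ × P3} (hv : DifferentiableAt ℝ v z)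
    (k : Fin 3) :
    c3 k (advt a v z) = ∑ i : Fin 3, c3 i (a z) * spd i (fun x => c3 k (v x)) z := by
  rw [c3_eq_c3L, advt, map_sum]
  refine Finset.sum_congr rfl fun i _ => ?_
  rw [map_smul, smul_eq_mul, ← c3_eq_c3L, spdv, c3_fderiv hv, spd]

lemma c3_pdtv {v : ℝ × P3 → P3} {z : ℝ × P3} (hv : DifferentiableAt ℝ v z) (k : Fin 3) :
    c3 k (pdtv v z) = pdts (fun x => c3 k (v x)) z :=
  c3_fderiv hv k _

lemma ContDiffAt.c3_comp {n : WithTop ℕ∞} {v : ℝ × P3 → P3} {z : ℝ × P3}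
    (hv : ContDiffAt ℝ n v z) (k : Fin 3) : ContDiffAt ℝ n (fun x => c3 k (v x)) z := by
  simp only [c3_eq_c3L]
  exact (c3L k).contDiff.contDiffAt.comp z hv

lemma ContDiffAt.differentiableAt_fderiv_apply {E : Type*} [NormedAddCommGroup E]
    [NormedSpace ℝ E] {f : E → ℝ} {z : E} (hf : ContDiffAt ℝ 2 f z) (a : E) :
    DifferentiableAt ℝ (fun x => fderiv ℝ f x a) z :=
  ((hf.fderiv_right (m := 1) (by norm_num)).differentiableAt (by norm_num)).clm_apply
    (differentiableAt_const a)

/-- Directional derivatives of a `C²` function commute. -/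
lemma ContDiffAt.fderiv_fderiv_apply_comm {E : Type*} [NormedAddCommGroup E]
    [NormedSpace ℝ E] {f : E → ℝ} {z : E} (hf : ContDiffAt ℝ 2 f z) (a b : E) :
    fderiv ℝ (fun x => fderiv ℝ f x a) z b = fderiv ℝ (fun x => fderiv ℝ f x b) z a := by
  have hd : DifferentiableAt ℝ (fderiv ℝ f) z :=
    (hf.fderiv_right (m := 1) (by norm_num)).differentiableAt (by norm_num)
  have key : ∀ a b : E, fderiv ℝ (fun x => fderiv ℝ f x a) z b
      = fderiv ℝ (fderiv ℝ f) z b a := by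
    intro a b
    rw [fderiv_clm_apply hd (differentiableAt_const a)]
    simp
  rw [key, key]
  exact (hf.isSymmSndFDerivAt (by simp)) b a

lemma differentiableAt_curlt {v : ℝ × P3 → P3} {z : ℝ × P3} (hv : ContDiffAt ℝ 2 v z) :
    DifferentiableAt ℝ (curlt v) z := by
  have hd : ∀ i k, DifferentiableAt ℝ (spd i (fun x => c3 k (v x))) z := fun i k =>
    (hv.c3_comp k).differentiableAt_fderiv_apply _
  exact ((hd 1 2).sub (hd 2 1)).prodMk (((hd 2 0).sub (hd 0 2)).prodMk ((hd 0 1).sub (hd 1 0)))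

/-- Directional derivative of the `k`-th component of `(a·∇)v`. -/
lemma fderiv_advt_component {a v : ℝ × P3 → P3} {z : ℝ × P3} (ha : ContDiffAt ℝ 2 a z)
    (hv : ContDiffAt ℝ 2 v z) (j k : Fin 3) :
    DifferentiableAt ℝ (fun x => ∑ i : Fin 3, c3 i (a x) * spd i (fun y => c3 k (v y)) x) z ∧
    spd j (fun x => ∑ i : Fin 3, c3 i (a x) * spd i (fun y => c3 k (v y)) x) z
      = ∑ i : Fin 3, (c3 i (a z) * spd i (spd j (fun y => c3 k (v y))) z
          + spd i (fun y => c3 k (v y)) z * spd j (fun x => c3 i (a x)) z) := by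
  have hd : ∀ i k, DifferentiableAt ℝ (spd i (fun x => c3 k (v x))) z := fun i k =>
    (hv.c3_comp k).differentiableAt_fderiv_apply _
  have had : ∀ i, DifferentiableAt ℝ (fun x => c3 i (a x)) z := fun i =>
    (ha.c3_comp i).differentiableAt (by norm_num)
  have hterm : ∀ i ∈ (Finset.univ : Finset (Fin 3)),
      DifferentiableAt ℝ (fun x => c3 i (a x) * spd i (fun y => c3 k (v y)) x) z :=
    fun i _ => (had i).mul (hd i k)
  refine ⟨DifferentiableAt.fun_sum hterm, ?_⟩
  unfold spd at hd hterm ⊢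
  rw [fderiv_fun_sum hterm, sum_apply]
  refine Finset.sum_congr rfl fun i _ => ?_
  rw [fderiv_fun_mul (had i) (hd i k)]
  simp only [add_apply, smul_apply, smul_eq_mul]
  rw [(hv.c3_comp k).fderiv_fderiv_apply_comm]

/-- The current equation for ideal incompressible MHD:
∂_t j + (u·∇)j − (h·∇)ω = (j·∇)u − (ω·∇)h − 2 Σ_l ∇u_l × ∇h_l,
where ω = ∇×u, j = ∇×h. -/
theorem current_equation
    (I : Set ℝ) (hIo : IsOpen I) (hIc : I.OrdConnected)
    (U : Set P3) (hU : IsOpen U)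
    (u h : ℝ × P3 → P3)
    (hu : ContDiffOn ℝ 2 u (I ×ˢ U)) (hh : ContDiffOn ℝ 2 h (I ×ˢ U))
    (hind : ∀ t ∈ I, ∀ y ∈ U,
      pdtv h (t, y) + advt u h (t, y) - advt h u (t, y) = 0)
    (hdivu : ∀ t ∈ I, ∀ y ∈ U, divt u (t, y) = 0)
    (hdivh : ∀ t ∈ I, ∀ y ∈ U, divt h (t, y) = 0) :
    ∀ t ∈ I, ∀ y ∈ U,
      pdtv (curlt h) (t, y) + advt u (curlt h) (t, y) - advt h (curlt u) (t, y)
        = advt (curlt h) u (t, y) - advt (curlt u) h (t, y)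
          - (2 : ℝ) • (∑ l : Fin 3,
              cross3 (gradt (fun w => c3 l (u w)) (t, y))
                     (gradt (fun w => c3 l (h w)) (t, y))) := by
  intro t ht y hy
  have hO : IsOpen (I ×ˢ U) := hIo.prod hU
  have hCu : ∀ z ∈ I ×ˢ U, ContDiffAt ℝ 2 u z := fun z hz => hu.contDiffAt (hO.mem_nhds hz)
  have hCh : ∀ z ∈ I ×ˢ U, ContDiffAt ℝ 2 h z := fun z hz => hh.contDiffAt (hO.mem_nhds hz)
  have hz : (t, y) ∈ I ×ˢ U := ⟨ht, hy⟩
  have hdu := hdivu t ht y hy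
  have hdh := hdivh t ht y hy
  generalize (t, y) = z at hz hdu hdh ⊢
  have hind' : ∀ k, (fun x => pdts (fun w => c3 k (h w)) x
      + ∑ i : Fin 3, c3 i (u x) * spd i (fun w => c3 k (h w)) x
      - ∑ i : Fin 3, c3 i (h x) * spd i (fun w => c3 k (u w)) x) =ᶠ[nhds z] fun _ => 0 := by
    intro k
    filter_upwards [hO.mem_nhds hz] with x hx
    have hux := (hCu x hx).differentiableAt (by norm_num)
    have hhx := (hCh x hx).differentiableAt (by norm_num)
    rw [← c3_advt u hhx, ← c3_advt h hux, ← c3_pdtv hhx]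
    have := congrArg (c3L k) (hind x.1 hx.1 x.2 hx.2)
    rw [map_sub, map_add, map_zero] at this
    simpa only [c3_eq_c3L] using this
  have hcu := hCu z hz
  have hch := hCh z hz
  have key : ∀ j k, pdts (spd j (fun w => c3 k (h w))) z
      + ∑ i : Fin 3, (c3 i (u z) * spd i (spd j (fun w => c3 k (h w))) z
          + spd i (fun w => c3 k (h w)) z * spd j (fun w => c3 i (u w)) z)
      - ∑ i : Fin 3, (c3 i (h z) * spd i (spd j (fun w => c3 k (u w))) z
          + spd i (fun w => c3 k (u w)) z * spd j (fun w => c3 i (h w)) z) = 0 := by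
    intro j k
    obtain ⟨d1, hu_adv⟩ := fderiv_advt_component hcu hch j k
    obtain ⟨d2, hh_adv⟩ := fderiv_advt_component hch hcu j k
    have d0 : DifferentiableAt ℝ (pdts (fun w => c3 k (h w))) z :=
      (hch.c3_comp k).differentiableAt_fderiv_apply _
    have h_comm : pdts (spd j (fun w => c3 k (h w))) z = spd j (pdts (fun w => c3 k (h w))) z :=
      (hch.c3_comp k).fderiv_fderiv_apply_comm _ _
    rw [h_comm, ← hu_adv, ← hh_adv]
    have := congrArg (fun L : ℝ × P3 →L[ℝ] ℝ => L (0, e3 j)) (hind' k).fderiv_eq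
    rw [fderiv_fun_sub (d0.fun_add d1) d2, fderiv_fun_add d0 d1] at this
    simpa [spd] using this
  have hdU : ∀ i k, DifferentiableAt ℝ (spd i (fun x => c3 k (u x))) z := fun i k =>
    (hcu.c3_comp k).differentiableAt_fderiv_apply _
  have hdH : ∀ i k, DifferentiableAt ℝ (spd i (fun x => c3 k (h x))) z := fun i k =>
    (hch.c3_comp k).differentiableAt_fderiv_apply _
  have spd_sub : ∀ (i : Fin 3) (f g : ℝ × P3 → ℝ), DifferentiableAt ℝ f z →
      DifferentiableAt ℝ g z → spd i (fun x => f x - g x) z = spd i f z - spd i g z := by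
    intro i f g hf hg
    simp only [spd]
    rw [fderiv_fun_sub hf hg]
    rfl
  have pdts_sub : ∀ f g : ℝ × P3 → ℝ, DifferentiableAt ℝ f z →
      DifferentiableAt ℝ g z → pdts (fun x => f x - g x) z = pdts f z - pdts g z := by
    intro f g hf hg
    simp only [pdts]
    rw [fderiv_fun_sub hf hg]
    rfl
  have curl0 : ∀ (v : ℝ × P3 → P3) (x : ℝ × P3), c3 0 (curlt v x)
      = spd 1 (fun w => c3 2 (v w)) x - spd 2 (fun w => c3 1 (v w)) x := fun _ _ => rfl
  have curl1 : ∀ (v : ℝ × P3 → P3) (x : ℝ × P3), c3 1 (curlt v x)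
      = spd 2 (fun w => c3 0 (v w)) x - spd 0 (fun w => c3 2 (v w)) x := fun _ _ => rfl
  have curl2 : ∀ (v : ℝ × P3 → P3) (x : ℝ × P3), c3 2 (curlt v x)
      = spd 0 (fun w => c3 1 (v w)) x - spd 1 (fun w => c3 0 (v w)) x := fun _ _ => rfl
  have cross0 : ∀ p q : ℝ × P3 → ℝ, c3L 0 (cross3 (gradt p z) (gradt q z))
      = spd 1 p z * spd 2 q z - spd 2 p z * spd 1 q z := fun _ _ => rfl
  have cross1 : ∀ p q : ℝ × P3 → ℝ, c3L 1 (cross3 (gradt p z) (gradt q z))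
      = spd 2 p z * spd 0 q z - spd 0 p z * spd 2 q z := fun _ _ => rfl
  have cross2 : ∀ p q : ℝ × P3 → ℝ, c3L 2 (cross3 (gradt p z) (gradt q z))
      = spd 0 p z * spd 1 q z - spd 1 p z * spd 0 q z := fun _ _ => rfl
  have hux := hcu.differentiableAt (by norm_num)
  have hhx := hch.differentiableAt (by norm_num)
  have hcurlu := differentiableAt_curlt hcu
  have hcurlh := differentiableAt_curlt hch
  simp only [divt, Fin.sum_univ_three] at hdu hdh
  simp only [Fin.sum_univ_three] at key
  refine ext_c3 fun k => ?_
  rw [c3_eq_c3L, c3_eq_c3L, map_sub, map_add, map_sub, map_sub, map_smul, map_sum, smul_eq_mul]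
  simp only [← c3_eq_c3L k (pdtv _ _), ← c3_eq_c3L k (advt _ _ _), c3_pdtv hcurlh,
    c3_advt _ hcurlh, c3_advt _ hcurlu, c3_advt _ hux, c3_advt _ hhx, Fin.sum_univ_three]
  fin_cases k
  · simp only [Fin.zero_eta, curl0, curl1, curl2, cross0,
      spd_sub _ _ _ (hdU _ _) (hdU _ _), spd_sub _ _ _ (hdH _ _) (hdH _ _),
      pdts_sub _ _ (hdH _ _) (hdH _ _)]
    linear_combination key 1 2 - key 2 1 - (spd 1 (fun w => c3 2 (h w)) z
      - spd 2 (fun w => c3 1 (h w)) z) * hdu + (spd 1 (fun w => c3 2 (u w)) z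
      - spd 2 (fun w => c3 1 (u w)) z) * hdh
  · simp only [Fin.mk_one, curl0, curl1, curl2, cross1,
      spd_sub _ _ _ (hdU _ _) (hdU _ _), spd_sub _ _ _ (hdH _ _) (hdH _ _),
      pdts_sub _ _ (hdH _ _) (hdH _ _)]
    linear_combination key 2 0 - key 0 2 - (spd 2 (fun w => c3 0 (h w)) z
      - spd 0 (fun w => c3 2 (h w)) z) * hdu + (spd 2 (fun w => c3 0 (u w)) z
      - spd 0 (fun w => c3 2 (u w)) z) * hdh
  · simp only [Fin.reduceFinMk, curl0, curl1, curl2, cross2,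
      spd_sub _ _ _ (hdU _ _) (hdU _ _), spd_sub _ _ _ (hdH _ _) (hdH _ _),
      pdts_sub _ _ (hdH _ _) (hdH _ _)]
    linear_combination key 0 1 - key 1 0 - (spd 0 (fun w => c3 1 (h w)) z
      - spd 1 (fun w => c3 0 (h w)) z) * hdu + (spd 0 (fun w => c3 1 (u w)) z
      - spd 1 (fun w => c3 0 (u w)) z) * hdh

end
end

section
/- Let U ⊆ ℝ³ be open and let u, h : U → ℝ³ be C¹ vector fields with div u = 0 and div h = 0 on U. Set ω = ∇×u and j = ∇×h. Then at every point of U and for each i ∈ {1,2,3}: Σ_{j,k,l=1}^{3} ε_{ijk} ∂ⱼu_l ∂_l h_k − Σ_{j,k,l=1}^{3} ε_{ijk} ∂ⱼh_l ∂_l u_k = −((j·∇)u)ᵢ + ((ω·∇)h)ᵢ + 2 (Σ_{l=1}^{3} ∇u_l × ∇h_l)ᵢ, where ε_{ijk} is the Levi-Civita symbol. -/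
noncomputable section

/-- The Levi-Civita symbol ε_{ijk} on indices in {0,1,2}. -/
def eps (i j k : Fin 3) : ℝ :=
  (((j.val : ℝ) - (i.val : ℝ)) * ((k.val : ℝ) - (i.val : ℝ))
      * ((k.val : ℝ) - (j.val : ℝ))) / 2

/-- Partial derivative ∂ᵢ of a scalar function on ℝ³. -/
def pd3 (i : Fin 3) (g : P3 → ℝ) (x : P3) : ℝ := fderiv ℝ g x (e3 i)

/-- Partial derivative ∂ᵢ of a vector field on ℝ³. -/
def pdv3 (i : Fin 3) (v : P3 → P3) (x : P3) : P3 := fderiv ℝ v x (e3 i)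

/-- The advective derivative (a·∇)v = Σ_k a_k ∂_k v. -/
def adv3 (a v : P3 → P3) (x : P3) : P3 := ∑ i : Fin 3, c3 i (a x) • pdv3 i v x

/-- The divergence of a vector field on ℝ³. -/
def div3 (v : P3 → P3) (x : P3) : ℝ := ∑ i : Fin 3, pd3 i (fun y => c3 i (v y)) x

/-- The gradient of a scalar function on ℝ³. -/
def grad3 (g : P3 → ℝ) (x : P3) : P3 := (pd3 0 g x, pd3 1 g x, pd3 2 g x)

/-- The curl ∇×v of a vector field on ℝ³, (∇×v)ᵢ = Σ_{j,k} ε_{ijk} ∂ⱼ v_k. -/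
def curl3 (v : P3 → P3) (x : P3) : P3 :=
  (pd3 1 (fun y => c3 2 (v y)) x - pd3 2 (fun y => c3 1 (v y)) x,
   pd3 2 (fun y => c3 0 (v y)) x - pd3 0 (fun y => c3 2 (v y)) x,
   pd3 0 (fun y => c3 1 (v y)) x - pd3 1 (fun y => c3 0 (v y)) x)

/-- Taking components commutes with partial differentiation at a point of differentiability. -/
theorem c3_pdv3 {v : P3 → P3} {x : P3} (hv : DifferentiableAt ℝ v x) (i k : Fin 3) :
    c3 k (pdv3 i v x) = pd3 i (fun y => c3 k (v y)) x := by
  have h1 := hv.hasFDerivAt.fst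
  have h2 := hv.hasFDerivAt.snd
  fin_cases k
  · exact (congrArg (fun L : P3 →L[ℝ] ℝ => L (e3 i)) h1.fderiv).symm
  · exact (congrArg (fun L : P3 →L[ℝ] ℝ => L (e3 i)) h2.fst.fderiv).symm
  · exact (congrArg (fun L : P3 →L[ℝ] ℝ => L (e3 i)) h2.snd.fderiv).symm

theorem c3_add (i : Fin 3) (a b : P3) : c3 i (a + b) = c3 i a + c3 i b := by
  fin_cases i <;> rfl

theorem c3_smul (i : Fin 3) (t : ℝ) (a : P3) : c3 i (t • a) = t * c3 i a := by
  fin_cases i <;> rfl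

theorem c3_adv3 {v : P3 → P3} {x : P3} (hv : DifferentiableAt ℝ v x) (a : P3 → P3) (i : Fin 3) :
    c3 i (adv3 a v x) = ∑ k : Fin 3, c3 k (a x) * pd3 k (fun y => c3 i (v y)) x := by
  simp only [adv3, Fin.sum_univ_three, c3_add, c3_smul, c3_pdv3 hv]

/-- The Levi-Civita identity at a single point, for trace-free matrices of partial derivatives:
`A j l` and `B j l` stand for `∂ⱼu_l` and `∂ⱼh_l`. -/
theorem levi_civita_algebra (A B : Fin 3 → Fin 3 → ℝ)
    (hA : ∑ i, A i i = 0) (hB : ∑ i, B i i = 0) (i : Fin 3) :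
    (∑ j : Fin 3, ∑ k : Fin 3, ∑ l : Fin 3, eps i j k * A j l * B l k)
        - (∑ j : Fin 3, ∑ k : Fin 3, ∑ l : Fin 3, eps i j k * B j l * A l k)
      = -(∑ m : Fin 3, c3 m (B 1 2 - B 2 1, B 2 0 - B 0 2, B 0 1 - B 1 0) * A m i)
        + (∑ m : Fin 3, c3 m (A 1 2 - A 2 1, A 2 0 - A 0 2, A 0 1 - A 1 0) * B m i)
        + 2 * c3 i (∑ l : Fin 3, cross3 (A 0 l, A 1 l, A 2 l) (B 0 l, B 1 l, B 2 l)) := by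
  rw [Fin.sum_univ_three] at hA hB
  have hA' : A 2 2 = -A 0 0 - A 1 1 := by linarith
  have hB' : B 2 2 = -B 0 0 - B 1 1 := by linarith
  fin_cases i <;>
    simp [Fin.sum_univ_three, eps, c3, cross3, hA', hB'] <;> ring

/-- The pointwise Levi-Civita identity:
Σ_{j,k,l} ε_{ijk} ∂ⱼu_l ∂_l h_k − Σ_{j,k,l} ε_{ijk} ∂ⱼh_l ∂_l u_k
  = −((j·∇)u)ᵢ + ((ω·∇)h)ᵢ + 2 (Σ_l ∇u_l × ∇h_l)ᵢ,
with ω = ∇×u, j = ∇×h, for divergence-free C¹ vector fields u, h. -/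
theorem levi_civita_identity
    (U : Set P3) (hU : IsOpen U)
    (u h : P3 → P3) (hu : ContDiffOn ℝ 1 u U) (hh : ContDiffOn ℝ 1 h U)
    (hdivu : ∀ x ∈ U, div3 u x = 0) (hdivh : ∀ x ∈ U, div3 h x = 0) :
    ∀ x ∈ U, ∀ i : Fin 3,
      (∑ j : Fin 3, ∑ k : Fin 3, ∑ l : Fin 3,
          eps i j k * pd3 j (fun y => c3 l (u y)) x * pd3 l (fun y => c3 k (h y)) x)
        - (∑ j : Fin 3, ∑ k : Fin 3, ∑ l : Fin 3,
          eps i j k * pd3 j (fun y => c3 l (h y)) x * pd3 l (fun y => c3 k (u y)) x)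
      = -(c3 i (adv3 (curl3 h) u x)) + c3 i (adv3 (curl3 u) h x)
        + 2 * c3 i (∑ l : Fin 3,
            cross3 (grad3 (fun y => c3 l (u y)) x) (grad3 (fun y => c3 l (h y)) x)) := by
  intro x hx i
  have hu' : DifferentiableAt ℝ u x :=
    (hu.contDiffAt (hU.mem_nhds hx)).differentiableAt one_ne_zero
  have hh' : DifferentiableAt ℝ h x :=
    (hh.contDiffAt (hU.mem_nhds hx)).differentiableAt one_ne_zero
  rw [c3_adv3 hu', c3_adv3 hh']
  exact levi_civita_algebra (fun j l => pd3 j (fun y => c3 l (u y)) x)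
    (fun j l => pd3 j (fun y => c3 l (h y)) x) (hdivu x hx) (hdivh x hx) i

end
end

section
/- There exists an absolute constant C > 0 such that for every C¹ map v = (v₁,v₂) : ℝ² → ℝ² that is 2π-periodic in each variable and every C² function G : ℝ² → ℝ that is 2π-periodic in each variable, one has | ∫_{[0,2π]²} (v₁∂₁G + v₂∂₂G) · (Σ_{i,j=1,2} vᵢ vⱼ ∂ᵢ∂ⱼG) dx | ≤ C ‖v‖²_{L∞} ‖∇v‖_{L∞} ∫_{[0,2π]²} (|∂₁G|² + |∂₂G|²) dx, where ‖v‖_{L∞} and ‖∇v‖_{L∞} are the sup norms of v and of all first partial derivatives of v. -/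
noncomputable section

open MeasureTheory

/-- The fundamental periodicity cell [0,2π]² in ℝ². -/
def Q2 : Set P2 := Set.Icc (0 : ℝ) (2 * Real.pi) ×ˢ Set.Icc (0 : ℝ) (2 * Real.pi)

/-- A function on ℝ² is 2π-periodic in each variable (i.e., lives on 𝕋²). -/
def Per2 {α : Type} (g : P2 → α) : Prop :=
  (∀ x : P2, g (x.1 + 2 * Real.pi, x.2) = g x) ∧
  (∀ x : P2, g (x.1, x.2 + 2 * Real.pi) = g x)

/-- The k-th Fourier coefficient ĝ(k) = (2π)⁻² ∫_{[0,2π]²} g(x) e^{−ik·x} dx. -/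
def fc (g : P2 → ℝ) (k : ℤ × ℤ) : ℂ :=
  (1 / (2 * Real.pi) ^ 2 : ℂ) *
    ∫ x in Q2, (g x : ℂ) *
      Complex.exp (-Complex.I * ((k.1 : ℂ) * (x.1 : ℂ) + (k.2 : ℂ) * (x.2 : ℂ)))

/-- The weight 1 + |k|² for k ∈ ℤ². -/
def wt (k : ℤ × ℤ) : ℝ := 1 + (k.1 : ℝ) ^ 2 + (k.2 : ℝ) ^ 2

/-- The squared Sobolev norm ‖g‖²_{H^σ} = Σ_k (1+|k|²)^σ |ĝ(k)|². -/
def HSq (σ : ℝ) (g : P2 → ℝ) : ℝ := ∑' k : ℤ × ℤ, wt k ^ σ * ‖fc g k‖ ^ 2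

/-- The squared L² norm ‖g‖²_{L²} = Σ_k |ĝ(k)|². -/
def L2Sq (g : P2 → ℝ) : ℝ := ∑' k : ℤ × ℤ, ‖fc g k‖ ^ 2

/-- The operator ⟨∇⟩^σ, defined via (⟨∇⟩^σ g)^∧(k) = (1+|k|²)^{σ/2} ĝ(k). -/
def Jop (σ : ℝ) (g : P2 → ℝ) (x : P2) : ℝ :=
  (∑' k : ℤ × ℤ, ((wt k ^ (σ / 2) : ℝ) : ℂ) * fc g k *
      Complex.exp (Complex.I * ((k.1 : ℂ) * (x.1 : ℂ) + (k.2 : ℂ) * (x.2 : ℂ)))).re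

/-- Components of a vector in ℝ². -/
def c2 : Fin 2 → P2 → ℝ := ![fun p => p.1, fun p => p.2]

/-- Partial derivative ∂ᵢ of a scalar function on ℝ². -/
def pd2 (i : Fin 2) (g : P2 → ℝ) (x : P2) : ℝ := fderiv ℝ g x (e2 i)

/-- Euclidean dot product on ℝ². -/
def dot2 (a b : P2) : ℝ := a.1 * b.1 + a.2 * b.2

theorem isCompact_Q2 : IsCompact Q2 := isCompact_Icc.prod isCompact_Icc

theorem Continuous.integrableOn_Q2 {g : P2 → ℝ} (hg : Continuous g) : IntegrableOn g Q2 :=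
  hg.continuousOn.integrableOn_compact isCompact_Q2

theorem Per2.exists_mem_Q2 {α : Type} {g : P2 → α} (h : Per2 g) (x : P2) :
    ∃ y ∈ Q2, g x = g y := by
  have hpi : (0 : ℝ) < 2 * Real.pi := by positivity
  obtain ⟨s, hs, hs'⟩ := Function.Periodic.exists_mem_Ico₀ (f := fun t => g (t, x.2))
    (c := 2 * Real.pi) (fun t => h.1 (t, x.2)) hpi x.1
  obtain ⟨t, ht, ht'⟩ := Function.Periodic.exists_mem_Ico₀ (f := fun t => g (s, t))
    (c := 2 * Real.pi) (fun t => h.2 (s, t)) hpi x.2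
  exact ⟨(s, t), ⟨Set.Ico_subset_Icc_self hs, Set.Ico_subset_Icc_self ht⟩, hs'.trans ht'⟩

theorem Per2.bddAbove_range {g : P2 → ℝ} (h : Per2 g) (hg : Continuous g) :
    BddAbove (Set.range g) := by
  refine (isCompact_Q2.image hg).bddAbove.mono ?_
  rintro _ ⟨x, rfl⟩
  obtain ⟨y, hy, hxy⟩ := h.exists_mem_Q2 x
  exact ⟨y, hy, hxy.symm⟩

theorem Per2.comp {α β : Type} {g : P2 → α} (h : Per2 g) (F : α → β) :
    Per2 (fun x => F (g x)) :=
  ⟨fun x => congrArg F (h.1 x), fun x => congrArg F (h.2 x)⟩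

theorem Per2.pd2 {g : P2 → ℝ} (h : Per2 g) (i : Fin 2) : Per2 (pd2 i g) := by
  have key : ∀ a : P2, (∀ x, g (x + a) = g x) → ∀ x, _root_.pd2 i g (x + a) = _root_.pd2 i g x := by
    intro a ha x
    unfold _root_.pd2
    rw [← fderiv_comp_add_right, funext ha]
  constructor
  · intro x
    have := key (2 * Real.pi, 0) (fun y => by simpa [Prod.add_def] using h.1 y) x
    simpa [Prod.add_def] using this
  · intro x
    have := key (0, 2 * Real.pi) (fun y => by simpa [Prod.add_def] using h.2 y) x
    simpa [Prod.add_def] using this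

theorem ContDiff.pd2 {n m : WithTop ℕ∞} {g : P2 → ℝ} (h : ContDiff ℝ n g) (hmn : m + 1 ≤ n)
    (i : Fin 2) : ContDiff ℝ m (pd2 i g) :=
  (h.fderiv_right hmn).clm_apply contDiff_const

theorem pd2_add {f g : P2 → ℝ} (i : Fin 2) (hf : Differentiable ℝ f) (hg : Differentiable ℝ g)
    (x : P2) : pd2 i (fun y => f y + g y) x = pd2 i f x + pd2 i g x := by
  simp [pd2, fderiv_fun_add (hf x) (hg x)]

theorem pd2_mul {f g : P2 → ℝ} (i : Fin 2) (hf : Differentiable ℝ f) (hg : Differentiable ℝ g)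
    (x : P2) : pd2 i (fun y => f y * g y) x = pd2 i f x * g x + f x * pd2 i g x := by
  simp [pd2, fderiv_fun_mul (hf x) (hg x)]
  ring

theorem integral_divergence_eq_zero {f g : P2 → ℝ} (hf : ContDiff ℝ 1 f) (hg : ContDiff ℝ 1 g)
    (pf : Per2 f) (pg : Per2 g) : ∫ x in Q2, (pd2 0 f x + pd2 1 g x) = 0 := by
  have hpi : (0 : ℝ) ≤ 2 * Real.pi := by positivity
  have hQ : Q2 = Set.Icc ((0 : ℝ), (0 : ℝ)) (2 * Real.pi, 2 * Real.pi) := Set.Icc_prod_Icc _ _ _ _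
  have hc : Continuous fun x => pd2 0 f x + pd2 1 g x :=
    (hf.pd2 (m := 0) (by simp) 0).continuous.add (hg.pd2 (m := 0) (by simp) 1).continuous
  have hint := hc.integrableOn_Q2
  have key := integral_divergence_prod_Icc_of_hasFDerivAt_of_le f g (fderiv ℝ f) (fderiv ℝ g)
    (0, 0) (2 * Real.pi, 2 * Real.pi) (Prod.mk_le_mk.2 ⟨hpi, hpi⟩)
    hf.continuous.continuousOn hg.continuous.continuousOn
    (fun x _ => (hf.differentiable one_ne_zero x).hasFDerivAt)
    (fun x _ => (hg.differentiable one_ne_zero x).hasFDerivAt) (hQ ▸ hint)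
  have h1 : ∀ y, f (2 * Real.pi, y) = f (0, y) := fun y => by simpa using pf.1 (0, y)
  have h2 : ∀ y, g (y, 2 * Real.pi) = g (y, 0) := fun y => by simpa using pg.2 (y, 0)
  simp only [h1, h2, sub_self, zero_add] at key
  rw [hQ]
  exact key

/-- The pointwise bound on the commutator terms left after integrating by parts; `p`, `q` are the
components of the velocity, `pᵢ`, `qᵢ` their partial derivatives, `a`, `b` those of `G`. -/
theorem abs_commutator_le {p q p₀ p₁ q₀ q₁ a b M L : ℝ} (hp : |p| ≤ M) (hq : |q| ≤ M)
    (hp₀ : |p₀| ≤ L) (hp₁ : |p₁| ≤ L) (hq₀ : |q₀| ≤ L) (hq₁ : |q₁| ≤ L) :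
    |(p₀ + q₁) * ((p * a + q * b) * (p * a + q * b)) / 2
        + (p * a + q * b) * (p * (p₀ * a + q₀ * b) + q * (p₁ * a + q₁ * b))|
      ≤ 6 * M ^ 2 * L * (a ^ 2 + b ^ 2) := by
  have hM : 0 ≤ M := (abs_nonneg p).trans hp
  have hL : 0 ≤ L := (abs_nonneg p₀).trans hp₀
  have lin : ∀ {r s c d N : ℝ}, 0 ≤ N → |r| ≤ N → |s| ≤ N → |r * c + s * d| ≤ N * (|c| + |d|) := by
    intro r s c d N hN hr hs
    calc |r * c + s * d| ≤ |r * c| + |s * d| := abs_add_le _ _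
      _ = |r| * |c| + |s| * |d| := by rw [abs_mul, abs_mul]
      _ ≤ N * |c| + N * |d| := by gcongr
      _ = N * (|c| + |d|) := by ring
  set S := |a| + |b| with hS
  have hS0 : 0 ≤ S := by positivity
  have hw : |p * a + q * b| ≤ M * S := lin hM hp hq
  have hR : |p * (p₀ * a + q₀ * b) + q * (p₁ * a + q₁ * b)| ≤ M * (L * S + L * S) :=
    (lin hM hp hq).trans (by gcongr <;> exact lin hL ‹_› ‹_›)
  have hdiv : |p₀ + q₁| ≤ L + L := (abs_add_le _ _).trans (add_le_add hp₀ hq₁)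
  have hSS : S ^ 2 ≤ 2 * (a ^ 2 + b ^ 2) := by
    rw [hS, ← sq_abs a, ← sq_abs b]
    nlinarith [sq_nonneg (|a| - |b|)]
  calc _ ≤ |p₀ + q₁| * (|p * a + q * b| * |p * a + q * b|) / 2
        + |p * a + q * b| * |p * (p₀ * a + q₀ * b) + q * (p₁ * a + q₁ * b)| := by
        refine (abs_add_le _ _).trans_eq ?_
        simp only [abs_div, abs_mul, abs_two]
    _ ≤ (L + L) * ((M * S) * (M * S)) / 2 + (M * S) * (M * (L * S + L * S)) := by gcongr
    _ = 3 * M ^ 2 * L * S ^ 2 := by ring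
    _ ≤ 3 * M ^ 2 * L * (2 * (a ^ 2 + b ^ 2)) := by gcongr
    _ = 6 * M ^ 2 * L * (a ^ 2 + b ^ 2) := by ring

/-- Integration-by-parts cancellation: the cubic advection term is bounded using only
first derivatives of G:
|∫ (v·∇G)(Σᵢⱼ vᵢvⱼ∂ᵢ∂ⱼG)| ≤ C ‖v‖²_∞ ‖∇v‖_∞ ∫ |∇G|². -/
theorem cubic_advection_cancellation :
    ∃ C : ℝ, 0 < C ∧
      ∀ (v : P2 → P2) (G : P2 → ℝ),
        ContDiff ℝ 1 v → ContDiff ℝ 2 G → Per2 v → Per2 G →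
        |∫ x in Q2, ((v x).1 * pd2 0 G x + (v x).2 * pd2 1 G x)
            * (∑ i : Fin 2, ∑ j : Fin 2,
                c2 i (v x) * c2 j (v x) * pd2 i (fun y => pd2 j G y) x)|
          ≤ C * (⨆ x : P2, ‖v x‖) ^ 2
              * (⨆ x : P2,
                  max (max |pd2 0 (fun y => (v y).1) x| |pd2 1 (fun y => (v y).1) x|)
                      (max |pd2 0 (fun y => (v y).2) x| |pd2 1 (fun y => (v y).2) x|))
              * ∫ x in Q2, ((pd2 0 G x) ^ 2 + (pd2 1 G x) ^ 2) := by
  refine ⟨6, by norm_num, fun v G hv hG pv pG => ?_⟩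
  set M := ⨆ x : P2, ‖v x‖
  set L := ⨆ x : P2,
    max (max |pd2 0 (fun y => (v y).1) x| |pd2 1 (fun y => (v y).1) x|)
      (max |pd2 0 (fun y => (v y).2) x| |pd2 1 (fun y => (v y).2) x|)
  set p : P2 → ℝ := fun y => (v y).1
  set q : P2 → ℝ := fun y => (v y).2
  have hp : ContDiff ℝ 1 p := contDiff_fst.comp hv
  have hq : ContDiff ℝ 1 q := contDiff_snd.comp hv
  have pp : Per2 p := pv.comp Prod.fst
  have pq : Per2 q := pv.comp Prod.snd
  have hA (i : Fin 2) : ContDiff ℝ 1 (pd2 i G) := hG.pd2 (by norm_num) i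
  have cp (i : Fin 2) : Continuous (pd2 i p) := (hp.pd2 (m := 0) (by simp) i).continuous
  have cq (i : Fin 2) : Continuous (pd2 i q) := (hq.pd2 (m := 0) (by simp) i).continuous
  have cA (i : Fin 2) : Continuous (pd2 i G) := (hA i).continuous
  have hM (x : P2) : ‖v x‖ ≤ M :=
    le_ciSup ((pv.comp fun z => ‖z‖).bddAbove_range hv.continuous.norm) x
  have hL (x : P2) : max (max |pd2 0 p x| |pd2 1 p x|) (max |pd2 0 q x| |pd2 1 q x|) ≤ L := by
    have per : Per2 fun x =>
        max (max |pd2 0 p x| |pd2 1 p x|) (max |pd2 0 q x| |pd2 1 q x|) :=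
      ⟨fun x => by simp only [(pp.pd2 _).1 x, (pq.pd2 _).1 x],
        fun x => by simp only [(pp.pd2 _).2 x, (pq.pd2 _).2 x]⟩
    exact le_ciSup (per.bddAbove_range
      (((cp 0).abs.max (cp 1).abs).max ((cq 0).abs.max (cq 1).abs))) x
  set w : P2 → ℝ := fun x => p x * pd2 0 G x + q x * pd2 1 G x with hwdef
  have hw : ContDiff ℝ 1 w := (hp.mul (hA 0)).add (hq.mul (hA 1))
  have pw : Per2 w :=
    ⟨fun x => by simp only [hwdef, pp.1 x, pq.1 x, (pG.pd2 _).1 x],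
      fun x => by simp only [hwdef, pp.2 x, pq.2 x, (pG.pd2 _).2 x]⟩
  have dp := hp.differentiable one_ne_zero
  have dq := hq.differentiable one_ne_zero
  have dw := hw.differentiable one_ne_zero
  have dA (i : Fin 2) := (hA i).differentiable one_ne_zero
  have hpw : ContDiff ℝ 1 fun x => p x * (w x * w x) := hp.mul (hw.mul hw)
  have hqw : ContDiff ℝ 1 fun x => q x * (w x * w x) := hq.mul (hw.mul hw)
  have hdiv := integral_divergence_eq_zero hpw hqw
    ⟨fun x => by simp only [pp.1 x, pw.1 x], fun x => by simp only [pp.2 x, pw.2 x]⟩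
    ⟨fun x => by simp only [pq.1 x, pw.1 x], fun x => by simp only [pq.2 x, pw.2 x]⟩
  set E : P2 → ℝ := fun x =>
    (pd2 0 p x + pd2 1 q x) * (w x * w x) / 2 + w x *
      (p x * (pd2 0 p x * pd2 0 G x + pd2 0 q x * pd2 1 G x)
        + q x * (pd2 1 p x * pd2 0 G x + pd2 1 q x * pd2 1 G x)) with hEdef
  have cE : Continuous E := by
    have := hp.continuous
    have := hq.continuous
    have := hw.continuous
    have := cp 0
    have := cp 1
    have := cq 0
    have := cq 1
    have := cA 0
    have := cA 1
    fun_prop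
  have wpd (i : Fin 2) (x : P2) : pd2 i w x = pd2 i p x * pd2 0 G x + p x * pd2 i (pd2 0 G) x
      + (pd2 i q x * pd2 1 G x + q x * pd2 i (pd2 1 G) x) := by
    rw [hwdef, pd2_add i (dp.fun_mul (dA 0)) (dq.fun_mul (dA 1)), pd2_mul i dp (dA 0),
      pd2_mul i dq (dA 1)]
  have hI (x : P2) : (p x * pd2 0 G x + q x * pd2 1 G x) * (∑ i : Fin 2, ∑ j : Fin 2,
        c2 i (v x) * c2 j (v x) * pd2 i (fun y => pd2 j G y) x)
      = (pd2 0 (fun x => p x * (w x * w x)) x + pd2 1 (fun x => q x * (w x * w x)) x) / 2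
        - E x := by
    have hc0 : c2 0 (v x) = p x := rfl
    have hc1 : c2 1 (v x) = q x := rfl
    rw [pd2_mul 0 dp (dw.fun_mul dw), pd2_mul 1 dq (dw.fun_mul dw), pd2_mul 0 dw dw, pd2_mul 1 dw dw,
      wpd 0, wpd 1]
    simp only [hEdef, hwdef, Fin.sum_univ_two, hc0, hc1]
    ring
  have hdivi : IntegrableOn (fun x => (pd2 0 (fun x => p x * (w x * w x)) x
      + pd2 1 (fun x => q x * (w x * w x)) x) / 2) Q2 :=
    (((hpw.pd2 (m := 0) (by simp) 0).continuous.add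
      (hqw.pd2 (m := 0) (by simp) 1).continuous).div_const 2).integrableOn_Q2
  have heq : ∫ x in Q2, (p x * pd2 0 G x + q x * pd2 1 G x) * (∑ i : Fin 2, ∑ j : Fin 2,
        c2 i (v x) * c2 j (v x) * pd2 i (fun y => pd2 j G y) x) = - ∫ x in Q2, E x := by
    simp_rw [hI]
    rw [integral_sub hdivi cE.integrableOn_Q2, integral_div, hdiv]
    simp
  change |∫ x in Q2, (p x * pd2 0 G x + q x * pd2 1 G x) * (∑ i : Fin 2, ∑ j : Fin 2,
        c2 i (v x) * c2 j (v x) * pd2 i (fun y => pd2 j G y) x)| ≤ _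
  rw [heq, abs_neg, ← Real.norm_eq_abs, ← integral_const_mul]
  refine norm_integral_le_of_norm_le
    (((((cA 0).pow 2).add ((cA 1).pow 2)).const_mul _).integrableOn_Q2)
    (Filter.Eventually.of_forall fun x => ?_)
  have hLx := hL x
  simp only [max_le_iff] at hLx
  exact abs_commutator_le ((norm_fst_le (v x)).trans (hM x)) ((norm_snd_le (v x)).trans (hM x))
    hLx.1.1 hLx.1.2 hLx.2.1 hLx.2.2

end
end
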